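/- arXiv:2211.12302 — 5 statements merged into one kernel-verified Lean document; each statement's English description precedes it below -/
import Mathlib

section
/- The function f(e, S) = eᵀ S⁻¹ e is jointly convex in (e, S) on ℝⁿ × (symmetric positive definite n×n real matrices): for any vectors e₁, e₂ ∈ ℝⁿ, any symmetric positive definite real n×n matrices S₁, S₂, and any t ∈ [0,1], one has ((t e₁ + (1−t) e₂)ᵀ (t S₁ + (1−t) S₂)⁻¹ (t e₁ + (1−t) e₂)) ≤ t (e₁ᵀ S₁⁻¹ e₁) + (1−t) (e₂ᵀ S₂⁻¹ e₂). -/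
open Matrix

/-- The quadratic form of `S⁻¹` dominates the affine functions `e ↦ 2 eᵀx - xᵀSx`. -/
theorem Matrix.PosDef.two_mul_dotProduct_sub_le_inv {n : Type*} [Fintype n] [DecidableEq n]
    {S : Matrix n n ℝ} (hS : S.PosDef) (e x : n → ℝ) :
    2 * (e ⬝ᵥ x) - x ⬝ᵥ S *ᵥ x ≤ e ⬝ᵥ S⁻¹ *ᵥ e := by
  obtain ⟨y, rfl⟩ : ∃ y, S *ᵥ y = e :=
    ⟨S⁻¹ *ᵥ e, by rw [mulVec_mulVec, mul_nonsing_inv _ ((isUnit_iff_isUnit_det S).1 hS.isUnit),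
      one_mulVec]⟩
  have hinv : S⁻¹ *ᵥ S *ᵥ y = y := by
    rw [mulVec_mulVec, nonsing_inv_mul _ ((isUnit_iff_isUnit_det S).1 hS.isUnit), one_mulVec]
  have hsymm : y ⬝ᵥ S *ᵥ x = x ⬝ᵥ S *ᵥ y := by
    have hT : Sᵀ = S := by simpa using hS.isHermitian.eq
    rw [dotProduct_mulVec, ← mulVec_transpose, hT, dotProduct_comm]
  have hnonneg := hS.posSemidef.dotProduct_mulVec_nonneg (y - x)
  simp only [star_trivial, mulVec_sub, sub_dotProduct, dotProduct_sub] at hnonneg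
  rw [hinv, dotProduct_comm _ x, dotProduct_comm _ y]
  linarith

/-- The function `f(e, S) = eᵀ S⁻¹ e` is jointly convex in `(e, S)` on
`ℝⁿ × (symmetric positive definite matrices)`. -/
theorem quadratic_form_inv_jointly_convex (n : ℕ)
    (e₁ e₂ : Fin n → ℝ) (S₁ S₂ : Matrix (Fin n) (Fin n) ℝ)
    (hS₁ : S₁.PosDef) (hS₂ : S₂.PosDef)
    (t : ℝ) (ht0 : 0 ≤ t) (ht1 : t ≤ 1) :
    (t • e₁ + (1 - t) • e₂) ⬝ᵥ (t • S₁ + (1 - t) • S₂)⁻¹ *ᵥ (t • e₁ + (1 - t) • e₂)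
      ≤ t * (e₁ ⬝ᵥ S₁⁻¹ *ᵥ e₁) + (1 - t) * (e₂ ⬝ᵥ S₂⁻¹ *ᵥ e₂) := by
  have hs : 0 ≤ 1 - t := sub_nonneg.2 ht1
  have hS : (t • S₁ + (1 - t) • S₂).PosDef := by
    rcases ht0.eq_or_lt with rfl | ht
    · simpa using hS₂
    · exact (hS₁.smul ht).add_posSemidef (hS₂.posSemidef.smul hs)
  set e := t • e₁ + (1 - t) • e₂ with he
  set S := t • S₁ + (1 - t) • S₂ with hSdef
  set x := S⁻¹ *ᵥ e with hx
  have hSx : S *ᵥ x = e := by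
    rw [hx, mulVec_mulVec, mul_nonsing_inv _ ((isUnit_iff_isUnit_det S).1 hS.isUnit), one_mulVec]
  have hquad : e ⬝ᵥ x = t * (x ⬝ᵥ S₁ *ᵥ x) + (1 - t) * (x ⬝ᵥ S₂ *ᵥ x) := by
    rw [dotProduct_comm, ← hSx, hSdef]
    simp only [add_mulVec, smul_mulVec, dotProduct_add, dotProduct_smul, smul_eq_mul]
  have hlin : e ⬝ᵥ x = t * (e₁ ⬝ᵥ x) + (1 - t) * (e₂ ⬝ᵥ x) := by
    simp only [he, add_dotProduct, smul_dotProduct, smul_eq_mul]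
  have h₁ := mul_le_mul_of_nonneg_left (hS₁.two_mul_dotProduct_sub_le_inv e₁ x) ht0
  have h₂ := mul_le_mul_of_nonneg_left (hS₂.two_mul_dotProduct_sub_le_inv e₂ x) hs
  linarith
end

section
/- For any symmetric positive definite real n×n matrix S, any vectors e, δe ∈ ℝⁿ and any symmetric real n×n matrix δS, the function t ↦ (e + t·δe)ᵀ (S + t·δS)⁻¹ (e + t·δe) is twice differentiable at t = 0, its second derivative at t = 0 equals 2·(δe − δS · M · e)ᵀ M (δe − δS · M · e) where M := S⁻¹, and in particular this second derivative is nonnegative. -/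
open Matrix

open Filter Topology

section QuadraticFormInv

variable {ι : Type*} [Fintype ι]

theorem HasDerivAt.dotProduct_real {u v : ℝ → ι → ℝ} {u' v' : ι → ℝ} {t : ℝ}
    (hu : HasDerivAt u u' t) (hv : HasDerivAt v v' t) :
    HasDerivAt (fun s => u s ⬝ᵥ v s) (u' ⬝ᵥ v t + u t ⬝ᵥ v') t := by
  simp only [dotProduct, ← Finset.sum_add_distrib]
  exact HasDerivAt.fun_sum fun i _ => (hasDerivAt_pi.1 hu i).mul (hasDerivAt_pi.1 hv i)

theorem hasDerivAt_add_smul (e d : ι → ℝ) (t : ℝ) :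
    HasDerivAt (fun s : ℝ => e + s • d) d t := by
  simpa using ((hasDerivAt_id t).smul_const d).const_add e

theorem Matrix.IsSymm.mulVec_dotProduct {M : Matrix ι ι ℝ} (hM : M.IsSymm) (u v : ι → ℝ) :
    M *ᵥ u ⬝ᵥ v = u ⬝ᵥ M *ᵥ v := by
  rw [dotProduct_mulVec, ← mulVec_transpose, hM.eq]

variable [DecidableEq ι]

/-- The determinant of an affine family of matrices is continuous in the parameter. -/
theorem Matrix.continuous_det_add_smul (S D : Matrix ι ι ℝ) :
    Continuous fun t : ℝ => (S + t • D).det := by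
  fun_prop

theorem Matrix.continuousAt_inv_add_smul (S D : Matrix ι ι ℝ) {t : ℝ}
    (ht : (S + t • D).det ≠ 0) : ContinuousAt (fun s : ℝ => (S + s • D)⁻¹) t := by
  have hinv : ContinuousAt Inv.inv (S + t • D) :=
    continuousAt_matrix_inv _ (by simpa only [Ring.inverse_eq_inv'] using continuousAt_inv₀ ht)
  exact hinv.comp (f := fun s : ℝ => S + s • D) (by fun_prop)

/-- The solution `x` of `(S + t D) x = e + t d` has derivative `(S + t D)⁻¹ (d - D x)`. -/
theorem Matrix.hasDerivAt_inv_add_smul_mulVec (S D : Matrix ι ι ℝ) (e d : ι → ℝ) {t : ℝ}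
    (ht : (S + t • D).det ≠ 0) :
    HasDerivAt (fun s : ℝ => (S + s • D)⁻¹ *ᵥ (e + s • d))
      ((S + t • D)⁻¹ *ᵥ (d - D *ᵥ (S + t • D)⁻¹ *ᵥ (e + t • d))) t := by
  set x := (S + t • D)⁻¹ *ᵥ (e + t • d) with hx
  have hSx : (S + t • D) *ᵥ x = e + t • d := by
    rw [hx, mulVec_mulVec, mul_nonsing_inv _ (isUnit_iff_ne_zero.2 ht), one_mulVec]
  clear_value x
  have hlim : Tendsto (fun s : ℝ => (S + s • D)⁻¹ *ᵥ (d - D *ᵥ x)) (𝓝[≠] t)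
      (𝓝 ((S + t • D)⁻¹ *ᵥ (d - D *ᵥ x))) := by
    have hc : Continuous fun M : Matrix ι ι ℝ => M *ᵥ (d - D *ᵥ x) := by fun_prop
    exact (hc.continuousAt.comp (continuousAt_inv_add_smul S D ht)).tendsto.mono_left
      nhdsWithin_le_nhds
  rw [hasDerivAt_iff_tendsto_slope]
  refine hlim.congr' ?_
  filter_upwards [self_mem_nhdsWithin, nhdsWithin_le_nhds
    ((continuous_det_add_smul S D).continuousAt.eventually_ne ht)] with s hs hdet
  have hres : e + s • d = (S + s • D) *ᵥ x + (s - t) • (d - D *ᵥ x) := by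
    have : S *ᵥ x = e + t • d - t • D *ᵥ x := by
      rw [← hSx, add_mulVec, smul_mulVec, add_sub_cancel_right]
    rw [add_mulVec, smul_mulVec, this]
    module
  rw [slope_def_module, ← hx, hres, mulVec_add, mulVec_mulVec,
    nonsing_inv_mul _ (isUnit_iff_ne_zero.2 hdet), one_mulVec, add_sub_cancel_left,
    mulVec_smul, smul_smul, inv_mul_cancel₀ (sub_ne_zero.2 hs), one_smul]

theorem Matrix.hasDerivAt_dotProduct_inv_add_smul_mulVec {S D : Matrix ι ι ℝ} (hS : S.IsSymm)
    (hD : D.IsSymm) (e d : ι → ℝ) {t : ℝ} (ht : (S + t • D).det ≠ 0) :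
    HasDerivAt (fun s : ℝ => (e + s • d) ⬝ᵥ (S + s • D)⁻¹ *ᵥ (e + s • d))
      (d ⬝ᵥ (S + t • D)⁻¹ *ᵥ (e + t • d) + (S + t • D)⁻¹ *ᵥ (e + t • d) ⬝ᵥ
        (d - D *ᵥ (S + t • D)⁻¹ *ᵥ (e + t • d))) t := by
  have hM : (S + t • D)⁻¹.IsSymm := by
    rw [IsSymm, transpose_nonsing_inv, (hS.add (hD.smul t)).eq]
  rw [hM.mulVec_dotProduct (e + t • d)]
  exact (hasDerivAt_add_smul e d t).dotProduct_real (hasDerivAt_inv_add_smul_mulVec S D e d ht)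

end QuadraticFormInv

/-- The map `g : t ↦ (e + t δe)ᵀ (S + t δS)⁻¹ (e + t δe)` is twice differentiable at
`t = 0`, its second derivative at `0` equals `2 (δe − δS M e)ᵀ M (δe − δS M e)` with
`M = S⁻¹`, and this second derivative is nonnegative. -/
theorem second_deriv_quadratic_form_inv (n : ℕ)
    (S : Matrix (Fin n) (Fin n) ℝ) (hS : S.PosDef)
    (e δe : Fin n → ℝ) (δS : Matrix (Fin n) (Fin n) ℝ) (hδS : δS.IsSymm) :
    DifferentiableAt ℝ
      (fun t : ℝ => (e + t • δe) ⬝ᵥ (S + t • δS)⁻¹ *ᵥ (e + t • δe)) 0 ∧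
    HasDerivAt
      (deriv fun t : ℝ => (e + t • δe) ⬝ᵥ (S + t • δS)⁻¹ *ᵥ (e + t • δe))
      (2 * ((δe - δS *ᵥ S⁻¹ *ᵥ e) ⬝ᵥ S⁻¹ *ᵥ (δe - δS *ᵥ S⁻¹ *ᵥ e))) 0 ∧
    0 ≤ 2 * ((δe - δS *ᵥ S⁻¹ *ᵥ e) ⬝ᵥ S⁻¹ *ᵥ (δe - δS *ᵥ S⁻¹ *ᵥ e)) := by
  have hSymm : S.IsSymm := by simpa [IsHermitian, IsSymm] using hS.isHermitian
  have hdet : (S + (0 : ℝ) • δS).det ≠ 0 := by simpa using hS.det_pos.ne'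
  refine ⟨(hasDerivAt_dotProduct_inv_add_smul_mulVec hSymm hδS e δe hdet).differentiableAt,
    ?_, ?_⟩
  · have hderiv := ((continuous_det_add_smul S δS).continuousAt.eventually_ne hdet).mono
      fun t ht => (hasDerivAt_dotProduct_inv_add_smul_mulVec hSymm hδS e δe ht).deriv
    refine HasDerivAt.congr_of_eventuallyEq ?_ hderiv
    have hx := hasDerivAt_inv_add_smul_mulVec S δS e δe hdet
    have hDx := (LinearMap.toContinuousLinearMap (mulVecLin δS)).hasFDerivAt.comp_hasDerivAt 0 hx
    have hsum := ((hasDerivAt_const (0 : ℝ) δe).dotProduct_real hx).add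
      (hx.dotProduct_real (hDx.const_sub δe))
    refine hsum.congr_deriv ?_
    simp only [zero_smul, add_zero, zero_dotProduct, zero_add, Function.comp_apply,
      LinearMap.coe_toContinuousLinearMap', mulVecLin_apply, dotProduct_neg]
    set y := S⁻¹ *ᵥ (δe - δS *ᵥ S⁻¹ *ᵥ e)
    rw [← hδS.mulVec_dotProduct, dotProduct_comm y, sub_dotProduct]
    ring
  · have h := hS.inv.posSemidef.dotProduct_mulVec_nonneg (δe - δS *ᵥ S⁻¹ *ᵥ e)
    rw [star_trivial] at h
    positivity
end

section
/- Let N ≥ 1 and let y_0, …, y_N ∈ ℝ. Define the trajectory-optimization objective J(α, x) := ∑_{k=0}^{N−1} (x_{k+1} − x_k)² + ∑_{k=0}^{N} (α·x_k − y_k)² for α ∈ ℝ and x = (x_0, …, x_N) ∈ ℝ^{N+1}. Then for every ε > 0, choosing x_k = ε·y_k for all k and α = 1/ε yields J(1/ε, (ε·y_k)_k) = ε² · ∑_{k=0}^{N−1} (y_{k+1} − y_k)². Consequently, the infimum of J(α, x) over all α ≥ 0 and x ∈ ℝ^{N+1} equals 0. -/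
/-- The trajectory-optimization objective
`J(α, x) = ∑_{k=0}^{N−1} (x_{k+1} − x_k)² + ∑_{k=0}^{N} (α x_k − y_k)²` for the scalar
random-walk model, where the states `x` and the parameter `α` are decision variables. -/
def trajObj (N : ℕ) (y : ℕ → ℝ) (α : ℝ) (x : ℕ → ℝ) : ℝ :=
  (∑ k ∈ Finset.range N, (x (k + 1) - x k) ^ 2)
    + ∑ k ∈ Finset.range (N + 1), (α * x k - y k) ^ 2

theorem trajObj_nonneg (N : ℕ) (y : ℕ → ℝ) (α : ℝ) (x : ℕ → ℝ) : 0 ≤ trajObj N y α x := by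
  unfold trajObj
  positivity

theorem trajObj_one_div_mul (N : ℕ) (y : ℕ → ℝ) {ε : ℝ} (hε : ε ≠ 0) :
    trajObj N y (1 / ε) (fun k => ε * y k)
      = ε ^ 2 * ∑ k ∈ Finset.range N, (y (k + 1) - y k) ^ 2 := by
  have hfit (k : ℕ) : (1 / ε * (ε * y k) - y k) ^ 2 = 0 := by
    field_simp
    ring
  simp only [trajObj, hfit, Finset.sum_const_zero, add_zero, Finset.mul_sum]
  exact Finset.sum_congr rfl fun k _ => by ring

/-- Choosing `x_k = ε y_k` and `α = 1/ε` gives objective value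
`ε² ∑_{k<N} (y_{k+1} − y_k)²`; consequently the infimum of `J(α, x)` over `α ≥ 0` and
`x ∈ ℝ^{N+1}` equals `0`. -/
theorem trajectory_optimization_infimum_zero (N : ℕ) (hN : 1 ≤ N) (y : ℕ → ℝ) :
    (∀ ε : ℝ, 0 < ε →
      trajObj N y (1 / ε) (fun k => ε * y k)
        = ε ^ 2 * ∑ k ∈ Finset.range N, (y (k + 1) - y k) ^ 2) ∧
    sInf {v : ℝ | ∃ (α : ℝ) (x : ℕ → ℝ), 0 ≤ α ∧ v = trajObj N y α x} = 0 := by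
  refine ⟨fun ε hε => trajObj_one_div_mul N y hε.ne', ?_⟩
  have hlower : ∀ v ∈ {v : ℝ | ∃ (α : ℝ) (x : ℕ → ℝ), 0 ≤ α ∧ v = trajObj N y α x}, 0 ≤ v := by
    rintro v ⟨α, x, -, rfl⟩
    exact trajObj_nonneg N y α x
  refine le_antisymm ?_ (Real.sInf_nonneg hlower)
  have hlim : Filter.Tendsto
      (fun ε : ℝ => ε ^ 2 * ∑ k ∈ Finset.range N, (y (k + 1) - y k) ^ 2)
      (nhdsWithin 0 (Set.Ioi 0)) (nhds 0) := by
    refine (Continuous.tendsto' ?_ 0 0 (by simp)).mono_left nhdsWithin_le_nhds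
    fun_prop
  refine ge_of_tendsto hlim ?_
  filter_upwards [self_mem_nhdsWithin] with ε (hε : 0 < ε)
  exact csInf_le ⟨0, hlower⟩
    ⟨1 / ε, fun k => ε * y k, by positivity, (trajObj_one_div_mul N y hε.ne').symm⟩
end

section
/- Let N ≥ 1 and let y_0, …, y_N ∈ ℝ be such that y_{k+1} ≠ y_k for at least one index k ∈ {0, …, N−1}. Define J(α, x) := ∑_{k=0}^{N−1} (x_{k+1} − x_k)² + ∑_{k=0}^{N} (α·x_k − y_k)² for α ∈ ℝ and x ∈ ℝ^{N+1}. Then J(α, x) > 0 for every α ≥ 0 and every x ∈ ℝ^{N+1}; since the infimum of J over α ≥ 0 and x ∈ ℝ^{N+1} is 0, this infimum is not attained, i.e., the trajectory-optimization problem has no minimizer. -/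
theorem trajObj_pos {N : ℕ} {y : ℕ → ℝ} (hy : ∃ k, k < N ∧ y (k + 1) ≠ y k)
    (α : ℝ) (x : ℕ → ℝ) : 0 < trajObj N y α x := by
  obtain ⟨k, hk, hne⟩ := hy
  have hS : (x (k + 1) - x k) ^ 2 ≤ ∑ i ∈ Finset.range N, (x (i + 1) - x i) ^ 2 :=
    Finset.single_le_sum (f := fun i => (x (i + 1) - x i) ^ 2) (fun i _ => sq_nonneg _)
      (Finset.mem_range.2 hk)
  have hT : ∀ j < N + 1, (α * x j - y j) ^ 2 ≤
      ∑ i ∈ Finset.range (N + 1), (α * x i - y i) ^ 2 := fun j hj =>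
    Finset.single_le_sum (f := fun i => (α * x i - y i) ^ 2) (fun i _ => sq_nonneg _)
      (Finset.mem_range.2 hj)
  have h₀ := hT k (by omega)
  have h₁ := hT (k + 1) (by omega)
  by_contra! hJ
  unfold trajObj at hJ
  have hx : x (k + 1) - x k = 0 := by
    apply pow_eq_zero_iff two_ne_zero |>.1
    nlinarith [sq_nonneg (x (k + 1) - x k), sq_nonneg (α * x k - y k)]
  have hy₀ : α * x k - y k = 0 := by
    apply pow_eq_zero_iff two_ne_zero |>.1
    nlinarith [sq_nonneg (x (k + 1) - x k), sq_nonneg (α * x k - y k)]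
  have hy₁ : α * x (k + 1) - y (k + 1) = 0 := by
    apply pow_eq_zero_iff two_ne_zero |>.1
    nlinarith [sq_nonneg (x (k + 1) - x k), sq_nonneg (α * x (k + 1) - y (k + 1))]
  apply hne
  linear_combination α * hx + hy₀ - hy₁

theorem trajObj_div (N : ℕ) (y : ℕ → ℝ) {β : ℝ} (hβ : β ≠ 0) :
    trajObj N y β (fun k => y k / β) =
      (∑ k ∈ Finset.range N, (y (k + 1) - y k) ^ 2) / β ^ 2 := by
  simp [trajObj, mul_div_cancel₀ _ hβ, ← sub_div, div_pow, Finset.sum_div]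

/-- The objective takes arbitrarily small values over `0 ≤ β`. -/
theorem exists_trajObj_lt (N : ℕ) (y : ℕ → ℝ) {ε : ℝ} (hε : 0 < ε) :
    ∃ (β : ℝ) (z : ℕ → ℝ), 0 ≤ β ∧ trajObj N y β z < ε := by
  set D := ∑ k ∈ Finset.range N, (y (k + 1) - y k) ^ 2 with hD
  have hD₀ : 0 ≤ D := Finset.sum_nonneg fun _ _ => sq_nonneg _
  have hq : 0 ≤ D / ε := by positivity
  refine ⟨1 + D / ε, fun k => y k / (1 + D / ε), by positivity, ?_⟩
  rw [trajObj_div N y (by positivity), ← hD, div_lt_comm₀ (by positivity) hε]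
  nlinarith

/-- If the data `y` is not constant, then `J(α, x) > 0` for every `α ≥ 0` and every `x`;
since the infimum of `J` over `α ≥ 0` and `x` is `0`, the infimum is not attained: the
trajectory-optimization problem has no minimizer. -/
theorem trajectory_optimization_no_minimizer (N : ℕ) (hN : 1 ≤ N) (y : ℕ → ℝ)
    (hy : ∃ k, k < N ∧ y (k + 1) ≠ y k) :
    (∀ (α : ℝ) (x : ℕ → ℝ), 0 ≤ α → 0 < trajObj N y α x) ∧
    ¬ ∃ (α : ℝ) (x : ℕ → ℝ), 0 ≤ α ∧
        ∀ (β : ℝ) (z : ℕ → ℝ), 0 ≤ β → trajObj N y α x ≤ trajObj N y β z := by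
  refine ⟨fun α x _ => trajObj_pos hy α x, ?_⟩
  rintro ⟨α, x, -, hmin⟩
  obtain ⟨β, z, hβ, hlt⟩ := exists_trajObj_lt N y (trajObj_pos hy α x)
  exact (hmin β z hβ).not_gt hlt
end

section
/- Consider the Kalman filter recursion: given real n×n matrices A_k, vectors b_k ∈ ℝⁿ, real m×n matrices C_k, symmetric positive semidefinite real n×n matrices Q_k, symmetric positive definite real m×m matrices R_k, measurements y_k ∈ ℝᵐ, an initial estimate x̂_0 ∈ ℝⁿ and a symmetric positive semidefinite initial covariance P_0, define S_k := C_k P_k C_kᵀ + R_k, K_k := P_k C_kᵀ S_k⁻¹, x̂_{k+1} := (A_k − K_k C_k) x̂_k + K_k y_k + b_k, and P_{k+1} := A_k (P_k − K_k C_k P_k) A_kᵀ + Q_k. Let λ > 0 and replace (P_0, Q_k, R_k) by (λ·P_0, λ·Q_k, λ·R_k) while keeping A_k, b_k, C_k, y_k and x̂_0 fixed. Then for every k the Kalman gains coincide, K_k^λ = K_k, and consequently the state estimates coincide, x̂_k^λ = x̂_k, and the output predictions C_k x̂_k^λ = C_k x̂_k coincide. -/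
open Matrix

/-- Over a field, the (total) matrix inverse is homogeneous of degree `-1`, even at singular
matrices. -/
theorem Matrix.inv_smul_of_ne_zero {ι 𝕜 : Type*} [Fintype ι] [DecidableEq ι] [Field 𝕜]
    {c : 𝕜} (hc : c ≠ 0) (M : Matrix ι ι 𝕜) : (c • M)⁻¹ = c⁻¹ • M⁻¹ := by
  by_cases hM : IsUnit M.det
  · exact M.inv_smul' (Units.mk0 c hc) hM
  · have hcM : ¬ IsUnit (c • M).det := by
      simpa [Matrix.det_smul, hc] using hM
    rw [nonsing_inv_apply_not_isUnit _ hM, nonsing_inv_apply_not_isUnit _ hcM, smul_zero]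

/-- The Kalman gain is unchanged when both covariances are multiplied by the same nonzero scalar. -/
theorem kalman_gain_smul {ι κ 𝕜 : Type*} [Fintype ι] [Fintype κ] [DecidableEq κ] [Field 𝕜]
    {c : 𝕜} (hc : c ≠ 0) (P : Matrix ι ι 𝕜) (C : Matrix κ ι 𝕜) (R : Matrix κ κ 𝕜) :
    (c • P) * Cᵀ * (C * (c • P) * Cᵀ + c • R)⁻¹ = P * Cᵀ * (C * P * Cᵀ + R)⁻¹ := by
  have hS : C * (c • P) * Cᵀ + c • R = c • (C * P * Cᵀ + R) := by
    simp only [Matrix.mul_smul, Matrix.smul_mul, smul_add]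
  rw [hS, Matrix.inv_smul_of_ne_zero hc]
  simp only [Matrix.mul_smul, Matrix.smul_mul, smul_smul, inv_mul_cancel₀ hc, one_smul]

/-- Scaling invariance of the Kalman filter predictions: replacing `(P₀, Q_k, R_k)` by
`(λ P₀, λ Q_k, λ R_k)` while keeping `A_k, b_k, C_k, y_k, x̂₀` fixed leaves the Kalman
gains, the state estimates and the output predictions unchanged. -/
theorem kalman_prediction_scale_invariance (n m : ℕ) (lam : ℝ) (hlam : 0 < lam)
    (A Q : ℕ → Matrix (Fin n) (Fin n) ℝ)
    (b : ℕ → Fin n → ℝ)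
    (C : ℕ → Matrix (Fin m) (Fin n) ℝ)
    (R : ℕ → Matrix (Fin m) (Fin m) ℝ)
    (y : ℕ → Fin m → ℝ)
    (hQ : ∀ k, (Q k).PosSemidef) (hR : ∀ k, (R k).PosDef)
    (x₀ : Fin n → ℝ) (P₀ : Matrix (Fin n) (Fin n) ℝ) (hP₀ : P₀.PosSemidef)
    (P Pl : ℕ → Matrix (Fin n) (Fin n) ℝ)
    (S Sl : ℕ → Matrix (Fin m) (Fin m) ℝ)
    (K Kl : ℕ → Matrix (Fin n) (Fin m) ℝ)
    (xhat xhatl : ℕ → Fin n → ℝ)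
    (hP0 : P 0 = P₀)
    (hx0 : xhat 0 = x₀)
    (hS : ∀ k, S k = C k * P k * (C k)ᵀ + R k)
    (hK : ∀ k, K k = P k * (C k)ᵀ * (S k)⁻¹)
    (hx : ∀ k, xhat (k + 1) = (A k - K k * C k) *ᵥ xhat k + K k *ᵥ y k + b k)
    (hP : ∀ k, P (k + 1) = A k * (P k - K k * C k * P k) * (A k)ᵀ + Q k)
    (hPl0 : Pl 0 = lam • P₀)
    (hxl0 : xhatl 0 = x₀)
    (hSl : ∀ k, Sl k = C k * Pl k * (C k)ᵀ + lam • R k)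
    (hKl : ∀ k, Kl k = Pl k * (C k)ᵀ * (Sl k)⁻¹)
    (hxl : ∀ k, xhatl (k + 1) = (A k - Kl k * C k) *ᵥ xhatl k + Kl k *ᵥ y k + b k)
    (hPl : ∀ k, Pl (k + 1) = A k * (Pl k - Kl k * C k * Pl k) * (A k)ᵀ + lam • Q k) :
    ∀ k, Kl k = K k ∧ xhatl k = xhat k ∧ C k *ᵥ xhatl k = C k *ᵥ xhat k := by
  have gain : ∀ k, Pl k = lam • P k → Kl k = K k := fun k h => by
    rw [hKl, hSl, h, hK, hS, kalman_gain_smul hlam.ne']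
  have cov : ∀ k, Pl k = lam • P k := by
    intro k
    induction k with
    | zero => rw [hPl0, hP0]
    | succ k ih =>
      rw [hPl, hP, gain k ih, ih]
      simp only [Matrix.mul_smul, Matrix.smul_mul, smul_add, ← smul_sub]
  have est : ∀ k, xhatl k = xhat k := by
    intro k
    induction k with
    | zero => rw [hxl0, hx0]
    | succ k ih => rw [hxl, hx, gain k (cov k), ih]
  exact fun k => ⟨gain k (cov k), est k, by rw [est k]⟩
end
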